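/- Fix n ≥ 2 and work in the exterior-form model Σ := ⋀•(ℂ^{2n−1}) with ω := Σ_{p=1}^{n−1} y_{2p}∧y_{2p+1}. Let K := span_ℂ{ ψ_k : −1 ≤ k ≤ n−1 } where ψ_k := ω^{k+1} − i(k+1)·y₁∧ω^k, and define Ψ₀ := Σ_{k=0}^{⌊(n−1)/2⌋} ((−1)^k/(2k+1)!)·ψ_{2k} and Ψ₁ := Σ_{k=0}^{⌊n/2⌋} ((−1)^k/(2k)!)·ψ_{2k−1}. Then: (1) c₂(Ψ₀) = Ψ₁; and (2) the set { Ψ ∈ K : c₂(Ψ) ∈ K } is a 2-dimensional complex subspace of K equal to span_ℂ{ Ψ₀, Ψ₁ }. (In the 3-Sasakian setting this subspace is the invariant part of the bundle E₂⁻ = 𝓔₂ associated to the second Sasakian structure.) -/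

import Mathlib

noncomputable section

/-- The underlying `(2n-1)`-dimensional complex vector space `ℂ^{2n-1}`. -/
abbrev ModelV (n : ℕ) : Type := Fin (2 * n - 1) → ℂ

/-- The exterior-form model `Σ = ⋀•(ℂ^{2n-1})` of the spinor module. -/
abbrev SpinorModel (n : ℕ) : Type := ExteriorAlgebra ℂ (ModelV n)

/-- The generator `y_{j+1}` (so `j` is the 0-based index), with junk value `0` out of range. -/
def yGen (n j : ℕ) : SpinorModel n :=
  if h : j < 2 * n - 1 then
    ExteriorAlgebra.ι ℂ (Pi.single (⟨j, h⟩ : Fin (2 * n - 1)) (1 : ℂ))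
  else 0

/-- Left exterior multiplication `y_{j+1} ∧ ·` (0-based index `j`). -/
def wdg (n j : ℕ) : SpinorModel n →ₗ[ℂ] SpinorModel n :=
  LinearMap.mulLeft ℂ (yGen n j)

/-- Contraction `x_{j+1} ⌟ ·` with the `(j+1)`-st dual basis vector (0-based index `j`),
with junk value `0` out of range. -/
def ctr (n j : ℕ) : SpinorModel n →ₗ[ℂ] SpinorModel n :=
  if h : j < 2 * n - 1 then
    CliffordAlgebra.contractLeft (LinearMap.proj (⟨j, h⟩ : Fin (2 * n - 1)))
  else 0

/-- The Clifford multiplication operators `c_a`, `1 ≤ a ≤ 4n-1`, of the exterior-form model: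
`c₁ = i·Id` on even degrees and `-i·Id` on odd degrees, `c_{2j} = i(x_j⌟ + y_j∧)` and
`c_{2j+1} = y_j∧ - x_j⌟` for `1 ≤ j ≤ 2n-1` (1-based indices). -/
def cop (n a : ℕ) : SpinorModel n →ₗ[ℂ] SpinorModel n :=
  if a = 1 then
    Complex.I • (CliffordAlgebra.involute : SpinorModel n →ₐ[ℂ] SpinorModel n).toLinearMap
  else if a % 2 = 0 then Complex.I • (ctr n (a / 2 - 1) + wdg n (a / 2 - 1))
  else wdg n (a / 2 - 1) - ctr n (a / 2 - 1)

/-- The invariant `2`-form `ω = ∑_{p=1}^{n-1} y_{2p} ∧ y_{2p+1}`. -/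
def om (n : ℕ) : SpinorModel n :=
  ∑ p ∈ Finset.Icc 1 (n - 1), yGen n (2 * p - 1) * yGen n (2 * p)

/-- The invariant Killing spinors `ψ_k = ω^{k+1} - i(k+1)·y₁∧ω^k`, reindexed by
`j = k + 1` (so `psi n j` is `ψ_{j-1}`, and `psi n 0 = ψ_{-1} = 1`). -/
def psi (n j : ℕ) : SpinorModel n :=
  om n ^ j - (Complex.I * (j : ℂ)) • (yGen n 0 * om n ^ (j - 1))

/-- The space of invariant spinors `Σ_inv = span_ℂ{ω^k, y₁∧ω^k : 0 ≤ k ≤ n-1}`. -/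
def Sinv (n : ℕ) : Submodule ℂ (SpinorModel n) :=
  Submodule.span ℂ {x | ∃ k ≤ n - 1, x = om n ^ k ∨ x = yGen n 0 * om n ^ k}

/-- The space of invariant Killing spinors `K = span_ℂ{ψ_k : -1 ≤ k ≤ n-1}`. -/
def KSpan (n : ℕ) : Submodule ℂ (SpinorModel n) :=
  Submodule.span ℂ {x | ∃ j ≤ n, x = psi n j}


/-- `Ψ_{𝓔₂,0} = ∑_{k=0}^{⌊(n-1)/2⌋} ((-1)^k/(2k+1)!)·ψ_{2k}` (recall `psi n j = ψ_{j-1}`). -/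
def PsiE2₀ (n : ℕ) : SpinorModel n :=
  ∑ k ∈ Finset.range ((n - 1) / 2 + 1),
    ((-1 : ℂ) ^ k / ((2 * k + 1).factorial : ℂ)) • psi n (2 * k + 1)

/-- `Ψ_{𝓔₂,1} = ∑_{k=0}^{⌊n/2⌋} ((-1)^k/(2k)!)·ψ_{2k-1}` (recall `psi n j = ψ_{j-1}`). -/
def PsiE2₁ (n : ℕ) : SpinorModel n :=
  ∑ k ∈ Finset.range (n / 2 + 1),
    ((-1 : ℂ) ^ k / ((2 * k).factorial : ℂ)) • psi n (2 * k)

section Contraction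

variable {n : ℕ}

lemma yGen_sq (j : ℕ) : yGen n j * yGen n j = 0 := by
  unfold yGen
  split_ifs <;> simp

lemma yGen_swap (j k : ℕ) : yGen n j * yGen n k = -(yGen n k * yGen n j) := by
  unfold yGen
  split_ifs <;> simp [eq_neg_iff_add_eq_zero]

/-- Products of two generators are central among the generators. -/
lemma yGen_mul_yGen_mul_yGen (a b c : ℕ) :
    yGen n a * yGen n b * yGen n c = yGen n c * (yGen n a * yGen n b) := by
  rw [mul_assoc, yGen_swap b c, mul_neg, ← mul_assoc, yGen_swap a c, neg_mul, neg_neg, mul_assoc]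

lemma commute_yGen_mul_yGen (a b c d : ℕ) :
    Commute (yGen n a * yGen n b) (yGen n c * yGen n d) := by
  rw [commute_iff_eq, ← mul_assoc, yGen_mul_yGen_mul_yGen, mul_assoc, yGen_mul_yGen_mul_yGen,
    mul_assoc]

lemma yGen_mul_yGen_sq (a b : ℕ) :
    yGen n a * yGen n b * (yGen n a * yGen n b) = 0 := by
  rw [← mul_assoc, yGen_mul_yGen_mul_yGen, ← mul_assoc, yGen_sq, zero_mul, zero_mul]

lemma ctr_one (j : ℕ) : ctr n j 1 = 0 := by
  unfold ctr
  split_ifs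
  · exact CliffordAlgebra.contractLeft_one (Q := (0 : QuadraticForm ℂ (ModelV n))) _
  · rfl

lemma ctr_yGen_mul_self {j : ℕ} (hj : j < 2 * n - 1) (z : SpinorModel n) :
    ctr n j (yGen n j * z) = z - yGen n j * ctr n j z := by
  simp only [ctr, yGen, dif_pos hj]
  refine (CliffordAlgebra.contractLeft_ι_mul (Q := (0 : QuadraticForm ℂ (ModelV n)))
    _ _ _).trans ?_
  simp

lemma ctr_yGen_mul_of_ne {j k : ℕ} (hjk : j ≠ k) (z : SpinorModel n) :
    ctr n j (yGen n k * z) = -(yGen n k * ctr n j z) := by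
  by_cases hj : j < 2 * n - 1
  · by_cases hk : k < 2 * n - 1
    · simp only [ctr, yGen, dif_pos hj, dif_pos hk]
      refine (CliffordAlgebra.contractLeft_ι_mul (Q := (0 : QuadraticForm ℂ (ModelV n)))
        _ _ _).trans ?_
      simp [hjk]
    · simp [yGen, hk]
  · simp [ctr, hj]

/-- The partial sums of `ω` over a set of indices. -/
def omSum (n : ℕ) (s : Finset ℕ) : SpinorModel n :=
  ∑ p ∈ s, yGen n (2 * p - 1) * yGen n (2 * p)

lemma ctr_omSum_mul {s : Finset ℕ} {j : ℕ} (hs : ∀ p ∈ s, j ≠ 2 * p - 1 ∧ j ≠ 2 * p)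
    (z : SpinorModel n) : ctr n j (omSum n s * z) = omSum n s * ctr n j z := by
  simp only [omSum, Finset.sum_mul, map_sum]
  refine Finset.sum_congr rfl fun p hp => ?_
  rw [mul_assoc, ctr_yGen_mul_of_ne (hs p hp).1, ctr_yGen_mul_of_ne (hs p hp).2, mul_neg, neg_neg,
    mul_assoc]

lemma ctr_omSum_pow {s : Finset ℕ} {j : ℕ} (hs : ∀ p ∈ s, j ≠ 2 * p - 1 ∧ j ≠ 2 * p) (k : ℕ) :
    ctr n j (omSum n s ^ k) = 0 := by
  induction k with
  | zero => rw [pow_zero, ctr_one]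
  | succ k ih => rw [pow_succ', ctr_omSum_mul hs, ih, mul_zero]

lemma add_pow_succ_of_mul_self_eq_zero {R : Type*} [Semiring R] {e S : R} (h : Commute e S)
    (he : e * e = 0) (m : ℕ) : (e + S) ^ (m + 1) = S ^ (m + 1) + (m + 1) • (e * S ^ m) := by
  induction m with
  | zero => simp [add_comm]
  | succ m ih =>
    have h1 : e * (e * S ^ m) = 0 := by rw [← mul_assoc, he, zero_mul]
    have h2 : S * (e * S ^ m) = e * S ^ (m + 1) := by
      rw [← mul_assoc, ← h.eq, mul_assoc, pow_succ']
    rw [pow_succ', ih, add_mul, mul_add, mul_add, mul_smul_comm, mul_smul_comm, h1, h2, smul_zero,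
      add_zero, ← pow_succ', succ_nsmul _ (m + 1)]
    abel

lemma omSum_insert_pow {s : Finset ℕ} {p : ℕ} (hp : p ∉ s) (m : ℕ) :
    omSum n (insert p s) ^ (m + 1) = omSum n s ^ (m + 1) +
      (m + 1) • (yGen n (2 * p - 1) * yGen n (2 * p) * omSum n s ^ m) := by
  rw [omSum, Finset.sum_insert hp]
  exact add_pow_succ_of_mul_self_eq_zero
    (Commute.sum_right _ _ _ fun _ _ => commute_yGen_mul_yGen _ _ _ _) (yGen_mul_yGen_sq _ _) m

lemma omSum_pow_card_succ (s : Finset ℕ) : omSum n s ^ (s.card + 1) = 0 := by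
  induction s using Finset.induction_on with
  | empty => simp [omSum]
  | insert p s hp ih =>
    rw [Finset.card_insert_of_notMem hp, omSum_insert_pow hp, pow_succ, ih, mul_zero, smul_zero,
      zero_mul, zero_add]

lemma omSum_pow_card_ne_zero (s : Finset ℕ) (hs : ∀ p ∈ s, 1 ≤ p ∧ p < n) :
    omSum n s ^ s.card ≠ 0 := by
  induction s using Finset.induction_on with
  | empty => simp
  | insert p s hp ih =>
    have ih := ih fun q hq => hs q (Finset.mem_insert_of_mem hq)
    have hpn := hs p (Finset.mem_insert_self p s)
    have hs' : ∀ q ∈ s, 1 ≤ q ∧ q ≠ p := fun q hq =>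
      ⟨(hs q (Finset.mem_insert_of_mem hq)).1, fun h => hp (h ▸ hq)⟩
    have ha : ctr n (2 * p - 1) (omSum n s ^ s.card) = 0 :=
      ctr_omSum_pow (fun q hq => by have := hs' q hq; omega) _
    have hb : ctr n (2 * p) (omSum n s ^ s.card) = 0 :=
      ctr_omSum_pow (fun q hq => by have := hs' q hq; omega) _
    rw [Finset.card_insert_of_notMem hp, omSum_insert_pow hp, omSum_pow_card_succ, zero_add]
    intro h
    rw [← Nat.cast_smul_eq_nsmul ℂ,
      smul_eq_zero_iff_right (Nat.cast_ne_zero.2 (Nat.succ_ne_zero _))] at h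
    apply ih
    have h2 := congrArg (fun z => ctr n (2 * p) (ctr n (2 * p - 1) z)) h
    simpa only [map_zero, mul_assoc, ctr_yGen_mul_self (show 2 * p - 1 < 2 * n - 1 by omega),
      ctr_yGen_mul_of_ne (show 2 * p - 1 ≠ 2 * p by omega), ha, mul_zero, neg_zero, sub_zero,
      ctr_yGen_mul_self (show 2 * p < 2 * n - 1 by omega), hb] using h2

lemma om_pow_self (hn : 1 ≤ n) : om n ^ n = 0 := by
  have h := omSum_pow_card_succ (n := n) (Finset.Icc 1 (n - 1))
  rwa [Nat.card_Icc, show n - 1 + 1 - 1 + 1 = n by omega] at h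

lemma om_pow_pred_ne_zero : om n ^ (n - 1) ≠ 0 := by
  have h := omSum_pow_card_ne_zero (n := n) (Finset.Icc 1 (n - 1)) fun p hp => by
    rw [Finset.mem_Icc] at hp; omega
  rwa [Nat.card_Icc, show n - 1 + 1 - 1 = n - 1 by omega] at h

lemma ctr_zero_om_pow (k : ℕ) : ctr n 0 (om n ^ k) = 0 :=
  ctr_omSum_pow (fun p hp => by rw [Finset.mem_Icc] at hp; omega) k

lemma ctr_zero_yGen_zero_mul_om_pow (hn : 1 ≤ n) (k : ℕ) :
    ctr n 0 (yGen n 0 * om n ^ k) = om n ^ k := by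
  rw [ctr_yGen_mul_self (by omega), ctr_zero_om_pow, mul_zero, sub_zero]

end Contraction

/-- The powers of a nilpotent element below its nilpotency index are linearly independent. -/
lemma eq_zero_of_sum_smul_pow_eq_zero {K A : Type*} [Field K] [Ring A] [Algebra K A] {w : A}
    {n : ℕ} (hw : w ^ n = 0) (hw' : w ^ (n - 1) ≠ 0) {a : ℕ → K}
    (h : ∑ k ∈ Finset.range n, a k • w ^ k = 0) : ∀ k < n, a k = 0 := by
  intro k
  induction k using Nat.strong_induction_on with
  | _ k ih =>
    intro hk
    have h1 := congrArg (w ^ (n - 1 - k) * ·) h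
    simp only [Finset.mul_sum, mul_zero, mul_smul_comm, ← pow_add] at h1
    rw [Finset.sum_eq_single_of_mem k (Finset.mem_range.2 hk)] at h1
    · rw [show n - 1 - k + k = n - 1 by omega] at h1
      exact (smul_eq_zero.1 h1).resolve_right hw'
    · intro j hj hjk
      rw [Finset.mem_range] at hj
      rcases lt_or_gt_of_ne hjk with hlt | hgt
      · rw [ih j hlt hj, zero_smul]
      · rw [pow_eq_zero_of_le (show n ≤ n - 1 - k + j by omega) hw, smul_zero]

section Expansion

variable {n : ℕ}

lemma eq_zero_of_sum_om_pow_add_eq_zero (hn : 1 ≤ n) {a b : ℕ → ℂ}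
    (h : ∑ k ∈ Finset.range n, (a k • om n ^ k + b k • (yGen n 0 * om n ^ k)) = 0) :
    ∀ k < n, a k = 0 ∧ b k = 0 := by
  have hb : ∀ k < n, b k = 0 := by
    apply eq_zero_of_sum_smul_pow_eq_zero (om_pow_self hn) om_pow_pred_ne_zero
    have h1 := congrArg (ctr n 0) h
    simpa [map_sum, ctr_zero_om_pow, ctr_zero_yGen_zero_mul_om_pow hn] using h1
  have ha : ∀ k < n, a k = 0 := by
    apply eq_zero_of_sum_smul_pow_eq_zero (om_pow_self hn) om_pow_pred_ne_zero
    rw [← h]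
    refine Finset.sum_congr rfl fun k hk => ?_
    rw [hb k (Finset.mem_range.1 hk), zero_smul, add_zero]
  exact fun k hk => ⟨ha k hk, hb k hk⟩

lemma sum_smul_psi (hn : 1 ≤ n) (a : ℕ → ℂ) :
    ∑ j ∈ Finset.range (n + 1), a j • psi n j =
      ∑ k ∈ Finset.range n, (a k • om n ^ k +
        (-(Complex.I * (k + 1) * a (k + 1))) • (yGen n 0 * om n ^ k)) := by
  simp only [psi, smul_sub, Finset.sum_sub_distrib, Finset.sum_add_distrib]
  rw [Finset.sum_range_succ, om_pow_self hn, smul_zero, add_zero, Finset.sum_range_succ',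
    sub_eq_add_neg]
  simp only [Nat.cast_zero, mul_zero, zero_smul, smul_zero, add_zero, Nat.add_sub_cancel,
    neg_smul, Finset.sum_neg_distrib, smul_smul]
  congr 2
  refine Finset.sum_congr rfl fun k _ => ?_
  push_cast
  ring_nf

lemma cop_two_apply (z : SpinorModel n) :
    cop n 2 z = Complex.I • (ctr n 0 z + yGen n 0 * z) := by
  simp [cop, wdg]

lemma cop_two_sum_smul_psi (hn : 1 ≤ n) (a : ℕ → ℂ) :
    cop n 2 (∑ j ∈ Finset.range (n + 1), a j • psi n j) =
      ∑ k ∈ Finset.range n, (((k + 1) * a (k + 1)) • om n ^ k +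
        (Complex.I * a k) • (yGen n 0 * om n ^ k)) := by
  rw [sum_smul_psi hn, map_sum]
  refine Finset.sum_congr rfl fun k _ => ?_
  rw [map_add, map_smul, map_smul, cop_two_apply, cop_two_apply, ctr_zero_om_pow,
    ctr_zero_yGen_zero_mul_om_pow hn, ← mul_assoc, yGen_sq, zero_mul, add_zero, zero_add,
    smul_smul, smul_smul, add_comm, mul_comm (a k)]
  congr 2
  linear_combination (-(k + 1) * a (k + 1)) * Complex.I_mul_I

lemma cop_two_sum_smul_psi_eq_iff (hn : 1 ≤ n) (a b : ℕ → ℂ) :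
    cop n 2 (∑ j ∈ Finset.range (n + 1), a j • psi n j) =
        ∑ j ∈ Finset.range (n + 1), b j • psi n j ↔
      ∀ k < n, b k = (k + 1) * a (k + 1) ∧ a k = -((k + 1) * b (k + 1)) := by
  rw [cop_two_sum_smul_psi hn, sum_smul_psi hn]
  constructor
  · intro h k hk
    rw [← sub_eq_zero, ← Finset.sum_sub_distrib] at h
    simp only [add_sub_add_comm, ← sub_smul] at h
    obtain ⟨h1, h2⟩ := eq_zero_of_sum_om_pow_add_eq_zero hn h k hk
    refine ⟨(sub_eq_zero.1 h1).symm, mul_left_cancel₀ Complex.I_ne_zero ?_⟩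
    linear_combination h2
  · intro h
    refine Finset.sum_congr rfl fun k hk => ?_
    obtain ⟨h1, h2⟩ := h k (Finset.mem_range.1 hk)
    rw [h1, h2]
    congr 2
    ring

lemma mem_KSpan_iff {Ψ : SpinorModel n} :
    Ψ ∈ KSpan n ↔ ∃ a : ℕ → ℂ, ∑ j ∈ Finset.range (n + 1), a j • psi n j = Ψ := by
  have h : {x | ∃ j ≤ n, x = psi n j} = psi n '' (Finset.range (n + 1) : Set ℕ) := by
    ext x
    simp [eq_comm]
  rw [KSpan, h, Submodule.mem_span_image_finset_iff_exists_fun']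

/-- The coefficients of the solution of the recursion `(k+1)(k+2) a_{k+2} = -a_k` with initial
values `a₀ = u`, `a₁ = v`. -/
def trigCoeff (u v : ℂ) (j : ℕ) : ℂ :=
  (if j % 2 = 0 then u else v) * ((-1) ^ (j / 2) / (j.factorial : ℂ))

lemma succ_mul_trigCoeff_succ (u v : ℂ) (k : ℕ) :
    (k + 1) * trigCoeff u v (k + 1) = trigCoeff v (-u) k := by
  have h1 : (k.factorial : ℂ) ≠ 0 := Nat.cast_ne_zero.2 k.factorial_ne_zero
  have h2 : (k + 1 : ℂ) ≠ 0 := Nat.cast_add_one_ne_zero k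
  rcases Nat.even_or_odd' k with ⟨m, rfl | rfl⟩
  · simp only [trigCoeff, Nat.factorial_succ, show (2 * m + 1) % 2 = 1 by omega,
      show (2 * m) % 2 = 0 by omega, show (2 * m + 1) / 2 = m by omega,
      show 2 * m / 2 = m by omega]
    push_cast at h2 ⊢
    field_simp
  · simp only [trigCoeff, Nat.factorial_succ (2 * m + 1), show (2 * m + 1 + 1) % 2 = 0 by omega,
      show (2 * m + 1) % 2 = 1 by omega, show (2 * m + 1) / 2 = m by omega,
      show (2 * m + 1 + 1) / 2 = m + 1 by omega]
    push_cast at h2 ⊢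
    field_simp
    ring

lemma trigCoeff_neg_neg (u v : ℂ) (k : ℕ) : trigCoeff (-u) (-v) k = -trigCoeff u v k := by
  unfold trigCoeff
  split_ifs <;> ring

lemma eq_trigCoeff_of_recursion {a : ℕ → ℂ}
    (h : ∀ k, k + 1 < n → a k = -((k + 1) * ((k + 2) * a (k + 2)))) :
    ∀ j ≤ n, a j = trigCoeff (a 0) (a 1) j := by
  intro j
  induction j using Nat.strong_induction_on with
  | _ j ih =>
    intro hj
    match j with
    | 0 => simp [trigCoeff]
    | 1 => simp [trigCoeff]
    | k + 2 =>
      have h1 := h k (by omega)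
      rw [ih k (by omega) (by omega)] at h1
      have h2 := succ_mul_trigCoeff_succ (a 0) (a 1) (k + 1)
      have h3 := succ_mul_trigCoeff_succ (a 1) (-a 0) k
      rw [← h2, trigCoeff_neg_neg] at h3
      have h4 : (k + 1 : ℂ) ≠ 0 := Nat.cast_add_one_ne_zero k
      have h5 : (k + 2 : ℂ) ≠ 0 := by exact_mod_cast Nat.succ_ne_zero (k + 1)
      push_cast at h3
      apply mul_left_cancel₀ (mul_ne_zero h4 h5)
      linear_combination h1 - h3

lemma sum_range_succ_eq_sum_even_add_sum_odd {M : Type*} [AddCommMonoid M] (f : ℕ → M)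
    (hn : 1 ≤ n) :
    ∑ j ∈ Finset.range (n + 1), f j = ∑ k ∈ Finset.range (n / 2 + 1), f (2 * k) +
      ∑ k ∈ Finset.range ((n - 1) / 2 + 1), f (2 * k + 1) := by
  induction n, hn using Nat.le_induction with
  | base => simp [Finset.sum_range_succ]
  | succ n hn ih =>
    rw [Finset.sum_range_succ, ih]
    rcases Nat.even_or_odd' n with ⟨m, rfl | rfl⟩
    · obtain ⟨l, rfl⟩ : ∃ l, m = l + 1 := ⟨m - 1, by omega⟩
      rw [show (2 * (l + 1) + 1) / 2 = 2 * (l + 1) / 2 by omega,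
        show (2 * (l + 1) + 1 - 1) / 2 + 1 = (2 * (l + 1) - 1) / 2 + 1 + 1 by omega,
        Finset.sum_range_succ _ ((2 * (l + 1) - 1) / 2 + 1),
        show (2 * (l + 1) - 1) / 2 + 1 = l + 1 by omega, add_assoc]
    · rw [show (2 * m + 1 + 1) / 2 = (2 * m + 1) / 2 + 1 by omega,
        show (2 * m + 1 + 1 - 1) / 2 = (2 * m + 1 - 1) / 2 by omega,
        Finset.sum_range_succ _ ((2 * m + 1) / 2 + 1),
        show (2 * m + 1) / 2 + 1 = m + 1 by omega, add_right_comm]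
      rfl

lemma sum_trigCoeff_smul_psi (hn : 1 ≤ n) (u v : ℂ) :
    ∑ j ∈ Finset.range (n + 1), trigCoeff u v j • psi n j = v • PsiE2₀ n + u • PsiE2₁ n := by
  rw [sum_range_succ_eq_sum_even_add_sum_odd _ hn, PsiE2₀, PsiE2₁, Finset.smul_sum,
    Finset.smul_sum, add_comm]
  congr 1 <;> refine Finset.sum_congr rfl fun k _ => ?_
  · rw [trigCoeff, show (2 * k + 1) / 2 = k by omega, if_neg (by omega), mul_smul]
  · rw [trigCoeff, show 2 * k / 2 = k by omega, if_pos (by omega), mul_smul]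

lemma cop_two_sum_trigCoeff (hn : 1 ≤ n) (u v : ℂ) :
    cop n 2 (∑ j ∈ Finset.range (n + 1), trigCoeff u v j • psi n j) =
      ∑ j ∈ Finset.range (n + 1), trigCoeff v (-u) j • psi n j :=
  (cop_two_sum_smul_psi_eq_iff hn _ _).2 fun k _ => by
    rw [succ_mul_trigCoeff_succ, succ_mul_trigCoeff_succ, trigCoeff_neg_neg, neg_neg]
    exact ⟨rfl, rfl⟩

lemma linearIndependent_PsiE2 (hn : 1 ≤ n) :
    LinearIndependent ℂ ![PsiE2₀ n, PsiE2₁ n] := by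
  rw [LinearIndependent.pair_iff]
  intro v u h
  rw [← sum_trigCoeff_smul_psi hn, sum_smul_psi hn] at h
  simpa [trigCoeff, and_comm] using eq_zero_of_sum_om_pow_add_eq_zero hn h 0 hn

end Expansion

/-- For `n ≥ 2`, within the space `K = span_ℂ{ψ_k : -1 ≤ k ≤ n-1}` of
invariant Killing spinors: (1) `c₂(Ψ₀) = Ψ₁`; and (2) the set `{Ψ ∈ K : c₂(Ψ) ∈ K}` is a
2-dimensional complex subspace of `K` equal to `span_ℂ{Ψ₀, Ψ₁}`. -/
theorem E2_invariant_part (n : ℕ) (hn : 2 ≤ n) :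
    cop n 2 (PsiE2₀ n) = PsiE2₁ n ∧
    {Ψ : SpinorModel n | Ψ ∈ KSpan n ∧ cop n 2 Ψ ∈ KSpan n} =
      (Submodule.span ℂ {PsiE2₀ n, PsiE2₁ n} : Submodule ℂ (SpinorModel n)) ∧
    Module.finrank ℂ (Submodule.span ℂ {PsiE2₀ n, PsiE2₁ n}) = 2 := by
  have hn1 : 1 ≤ n := by omega
  refine ⟨?_, ?_, ?_⟩
  · have h := cop_two_sum_trigCoeff hn1 0 1
    simpa only [sum_trigCoeff_smul_psi hn1, neg_zero, zero_smul, one_smul, add_zero, zero_add]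
      using h
  · ext Ψ
    rw [Set.mem_ofPred_eq, SetLike.mem_coe, Submodule.mem_span_pair]
    constructor
    · rintro ⟨h, h'⟩
      obtain ⟨a, rfl⟩ := mem_KSpan_iff.1 h
      obtain ⟨b, hb⟩ := mem_KSpan_iff.1 h'
      have hab := (cop_two_sum_smul_psi_eq_iff hn1 a b).1 hb.symm
      have ha := eq_trigCoeff_of_recursion (n := n) (a := a) fun k hk => by
        rw [(hab k (by omega)).2, (hab (k + 1) hk).1]
        push_cast
        ring
      refine ⟨a 1, a 0, ?_⟩
      rw [← sum_trigCoeff_smul_psi hn1]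
      refine Finset.sum_congr rfl fun j hj => ?_
      rw [← ha j (by rw [Finset.mem_range] at hj; omega)]
    · rintro ⟨v, u, rfl⟩
      rw [← sum_trigCoeff_smul_psi hn1]
      exact ⟨mem_KSpan_iff.2 ⟨_, rfl⟩, mem_KSpan_iff.2 ⟨_, (cop_two_sum_trigCoeff hn1 u v).symm⟩⟩
  · have h := finrank_span_eq_card (linearIndependent_PsiE2 hn1)
    rwa [Matrix.range_cons, Matrix.range_cons, Matrix.range_empty, Set.union_empty,
      Set.singleton_union, Fintype.card_fin] at h
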